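/- arXiv:2102.06967 — 2 statements merged into one kernel-verified Lean document; each statement's English description precedes it below -/
import Mathlib

section
/- Let (X, κ₁, κ₂) be a bispace such that for each i, j ∈ {1,2} with i ≠ j the family of sκᵢ-closed subsets of X coincides with the family of sκⱼ-open subsets of X. Then every subset of X is (j−i)sg*κ-closed for all i, j ∈ {1,2} with i ≠ j if and only if for each i ∈ {1,2} the intersection of any (arbitrary) family of κᵢ-closed sets is sκᵢ-closed. -/
open Set

/-- A σ-space (Alexandroff space): ∅ and X are open, countable unions and
finite (binary) intersections of open sets are open. -/
structure SigmaSpace (X : Type*) where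
  opens : Set (Set X)
  empty_mem : ∅ ∈ opens
  univ_mem : Set.univ ∈ opens
  sUnion_mem : ∀ S : Set (Set X), S.Countable → S ⊆ opens → ⋃₀ S ∈ opens
  inter_mem : ∀ A B : Set X, A ∈ opens → B ∈ opens → A ∩ B ∈ opens

variable {X : Type*}

/-- A set is κ-open if it belongs to the family of opens. -/
def SigmaSpace.IsOpen (κ : SigmaSpace X) (A : Set X) : Prop := A ∈ κ.opens

/-- A set is κ-closed if its complement is κ-open. -/
def SigmaSpace.IsClosed (κ : SigmaSpace X) (A : Set X) : Prop := Aᶜ ∈ κ.opens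

/-- The κ-closure of `A`: points all of whose κ-open neighbourhoods meet `A`. -/
def SigmaSpace.cl (κ : SigmaSpace X) (A : Set X) : Set X :=
  {x | ∀ U ∈ κ.opens, x ∈ U → (U ∩ A).Nonempty}

/-- `B` is semi κ-open if there is a κ-open `G` with `G ⊆ B ⊆ cl G`. -/
def SigmaSpace.SemiOpen (κ : SigmaSpace X) (B : Set X) : Prop :=
  ∃ G ∈ κ.opens, G ⊆ B ∧ B ⊆ κ.cl G

/-- `B` is semi κ-closed if its complement is semi κ-open. -/
def SigmaSpace.SemiClosed (κ : SigmaSpace X) (B : Set X) : Prop :=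
  κ.SemiOpen Bᶜ

/-- The semi κ-closure of `A`: points all of whose semi κ-open neighbourhoods meet `A`. -/
def SigmaSpace.scl (κ : SigmaSpace X) (A : Set X) : Set X :=
  {x | ∀ U, κ.SemiOpen U → x ∈ U → (U ∩ A).Nonempty}

/-- `B` is (j−i)sg*κ-closed in the bispace `κ` (where `i j : Fin 2` index the two
σ-structures): there is an sκᵢ-closed set `F ⊇ B` such that `F ⊆ O` whenever
`O` is sκⱼ-open and `B ⊆ O`. -/
def SgClosed (κ : Fin 2 → SigmaSpace X) (i j : Fin 2) (B : Set X) : Prop :=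
  ∃ F, (κ i).SemiClosed F ∧ B ⊆ F ∧ ∀ O, (κ j).SemiOpen O → B ⊆ O → F ⊆ O

/-- `B` is (j−i)sg*κ-open if its complement is (j−i)sg*κ-closed. -/
def SgOpen (κ : Fin 2 → SigmaSpace X) (i j : Fin 2) (B : Set X) : Prop :=
  SgClosed κ i j Bᶜ

/-- The semi-kernel of `B` w.r.t. `κ j`: the intersection of all sκⱼ-open sets containing `B`. -/
def sker (κ : Fin 2 → SigmaSpace X) (j : Fin 2) (B : Set X) : Set X :=
  ⋂₀ {U | (κ j).SemiOpen U ∧ B ⊆ U}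

/-- Pairwise semi-T₀. -/
def PairwiseSemiT0 (κ : Fin 2 → SigmaSpace X) : Prop :=
  ∀ x y : X, x ≠ y →
    (∃ U, (κ 0).SemiOpen U ∧ x ∈ U ∧ y ∉ U) ∨
    (∃ V, (κ 1).SemiOpen V ∧ y ∈ V ∧ x ∉ V)

/-- Pairwise semi-T₁. -/
def PairwiseSemiT1 (κ : Fin 2 → SigmaSpace X) : Prop :=
  ∀ x y : X, x ≠ y →
    (∃ U, (κ 0).SemiOpen U ∧ x ∈ U ∧ y ∉ U) ∧
    (∃ V, (κ 1).SemiOpen V ∧ y ∈ V ∧ x ∉ V)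

/-- Pairwise semi-R₀. -/
def PairwiseSemiR0 (κ : Fin 2 → SigmaSpace X) : Prop :=
  ∀ i j : Fin 2, i ≠ j → ∀ U, (κ i).SemiOpen U → ∀ x ∈ U, (κ j).scl {x} ⊆ U

/-- Pairwise semi-symmetric. -/
def PairwiseSemiSymmetric (κ : Fin 2 → SigmaSpace X) : Prop :=
  ∀ x y : X, ∀ i j : Fin 2, i ≠ j → x ∈ (κ i).scl {y} → y ∈ (κ j).scl {x}

/-- Pairwise strongly semi-symmetric: every singleton is (j−i)sg*κ-closed. -/
def PairwiseStronglySemiSymmetric (κ : Fin 2 → SigmaSpace X) : Prop :=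
  ∀ x : X, ∀ i j : Fin 2, i ≠ j → SgClosed κ i j {x}

/-- Pairwise semi-T_ω: every (j−i)sg*κ-closed set is sκᵢ-closed. -/
def PairwiseSemiTOmega (κ : Fin 2 → SigmaSpace X) : Prop :=
  ∀ i j : Fin 2, i ≠ j → ∀ B : Set X, SgClosed κ i j B → (κ i).SemiClosed B

/-- The (j−i)sg*κ-closure of `D`. -/
def sgCl (κ : Fin 2 → SigmaSpace X) (i j : Fin 2) (D : Set X) : Set X :=
  ⋂₀ {A | D ⊆ A ∧ SgClosed κ i j A}

theorem SigmaSpace.cl_mono (κ : SigmaSpace X) {A B : Set X} (hAB : A ⊆ B) :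
    κ.cl A ⊆ κ.cl B :=
  fun _ hx U hU hxU => (hx U hU hxU).mono (inter_subset_inter_right U hAB)

theorem SigmaSpace.cl_cl_subset (κ : SigmaSpace X) (A : Set X) : κ.cl (κ.cl A) ⊆ κ.cl A := by
  intro x hx U hU hxU
  obtain ⟨y, hyU, hy⟩ := hx U hU hxU
  exact hy U hU hyU

theorem SigmaSpace.subset_cl (κ : SigmaSpace X) (A : Set X) : A ⊆ κ.cl A :=
  fun x hx _ _ hxU => ⟨x, hxU, hx⟩

theorem SigmaSpace.IsClosed.semiClosed {κ : SigmaSpace X} {A : Set X} (hA : κ.IsClosed A) :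
    κ.SemiClosed A :=
  ⟨Aᶜ, hA, Subset.rfl, κ.subset_cl _⟩

/-- If arbitrary intersections of closed sets are semi-closed, then arbitrary unions of semi-open
sets are semi-open. -/
theorem SigmaSpace.semiOpen_sUnion {κ : SigmaSpace X}
    (h : ∀ S : Set (Set X), (∀ P ∈ S, κ.IsClosed P) → κ.SemiClosed (⋂₀ S))
    {T : Set (Set X)} (hT : ∀ B ∈ T, κ.SemiOpen B) : κ.SemiOpen (⋃₀ T) := by
  choose! G hG hGB hBG using hT
  obtain ⟨O, hO, hOG, hGO⟩ := h ((fun B => (G B)ᶜ) '' T) (by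
    rintro _ ⟨B, hB, rfl⟩
    simpa [SigmaSpace.IsClosed] using hG B hB)
  have hU : (⋂₀ ((fun B => (G B)ᶜ) '' T))ᶜ = ⋃ B ∈ T, G B := by
    simp [sInter_image, compl_iInter]
  rw [hU] at hOG hGO
  refine ⟨O, hO, hOG.trans (iUnion₂_subset fun B hB => (hGB B hB).trans
    (subset_sUnion_of_mem hB)), sUnion_subset fun B hB => ?_⟩
  have hGU : G B ⊆ κ.cl O := (subset_biUnion_of_mem (u := G) hB).trans hGO
  exact (hBG B hB).trans ((κ.cl_mono hGU).trans (κ.cl_cl_subset O))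

theorem SigmaSpace.semiClosed_sInter {κ : SigmaSpace X}
    (h : ∀ S : Set (Set X), (∀ P ∈ S, κ.IsClosed P) → κ.SemiClosed (⋂₀ S))
    {T : Set (Set X)} (hT : ∀ B ∈ T, κ.SemiClosed B) : κ.SemiClosed (⋂₀ T) := by
  rw [SigmaSpace.SemiClosed, compl_sInter]
  refine SigmaSpace.semiOpen_sUnion h ?_
  rintro _ ⟨B, hB, rfl⟩
  exact hT B hB

theorem stmt9 {X : Type*} (κ : Fin 2 → SigmaSpace X)
    (h : ∀ i j : Fin 2, i ≠ j → ∀ A : Set X, (κ i).SemiClosed A ↔ (κ j).SemiOpen A) :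
    (∀ i j : Fin 2, i ≠ j → ∀ B : Set X, SgClosed κ i j B) ↔
      (∀ i : Fin 2, ∀ S : Set (Set X),
        (∀ P ∈ S, (κ i).IsClosed P) → (κ i).SemiClosed (⋂₀ S)) := by
  constructor
  · intro hsg i S hS
    obtain ⟨j, hij⟩ := exists_ne i
    obtain ⟨F, hF, hSF, hmin⟩ := hsg i j hij.symm (⋂₀ S)
    have hFS : F ⊆ ⋂₀ S := subset_sInter fun P hP =>
      hmin P ((h i j hij.symm P).1 (hS P hP).semiClosed) (sInter_subset_of_mem hP)
    rwa [hSF.antisymm hFS]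
  · intro hcl i j hij B
    exact ⟨sker κ j B,
      SigmaSpace.semiClosed_sInter (hcl i) fun U hU => (h i j hij U).2 hU.1,
      subset_sInter fun U hU => hU.2,
      fun O hO hBO => sInter_subset_of_mem ⟨hO, hBO⟩⟩
end

section
/- A bispace (X, κ₁, κ₂) is pairwise semi-T_ω if and only if both of the following hold: (a) for each x ∈ X and each i, j ∈ {1,2} with i ≠ j, if {x} is not sκᵢ-closed then {x} is sκⱼ-open; and (b) for each i, j ∈ {1,2} with i ≠ j, 𝒢ᵢ = 𝒢ᵢ'. -/
open Set

variable {X : Type*}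

theorem SigmaSpace.SemiClosed.sgClosed {X : Type*} {κ : Fin 2 → SigmaSpace X} {i : Fin 2}
    {B : Set X} (h : (κ i).SemiClosed B) (j : Fin 2) : SgClosed κ i j B :=
  ⟨B, h, Subset.rfl, fun _ _ hO => hO⟩

theorem SigmaSpace.subset_scl {X : Type*} (κ : SigmaSpace X) (A : Set X) : A ⊆ κ.scl A :=
  fun x hx _ _ hxU => ⟨x, hxU, hx⟩

theorem SigmaSpace.scl_subset {X : Type*} {κ : SigmaSpace X} {A F : Set X}
    (hF : κ.SemiClosed F) (hAF : A ⊆ F) : κ.scl A ⊆ F := by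
  intro x hx
  by_contra hxF
  obtain ⟨y, hyF, hyA⟩ := hx Fᶜ hF hxF
  exact hyF (hAF hyA)

theorem SigmaSpace.scl_eq_sInter {X : Type*} (κ : SigmaSpace X) (A : Set X) :
    κ.scl A = ⋂₀ {F | A ⊆ F ∧ κ.SemiClosed F} := by
  refine Subset.antisymm (fun x hx F hF => scl_subset hF.2 hF.1 hx) fun x hx U hU hxU => ?_
  by_contra hne
  refine hx Uᶜ ⟨fun y hyA hyU => hne ⟨y, hyU, hyA⟩, ?_⟩ hxU
  rwa [SemiClosed, compl_compl]

theorem SgClosed.sgCl_eq {X : Type*} {κ : Fin 2 → SigmaSpace X} {i j : Fin 2} {B : Set X}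
    (h : SgClosed κ i j B) : sgCl κ i j B = B :=
  Subset.antisymm (sInter_subset_of_mem ⟨Subset.rfl, h⟩) (subset_sInter fun _ hA => hA.1)

theorem sgClosed_compl_singleton {X : Type*} {κ : Fin 2 → SigmaSpace X} {j : Fin 2} {x : X}
    (i : Fin 2) (h : ¬ (κ j).SemiClosed {x}) : SgClosed κ i j {x}ᶜ := by
  refine ⟨univ, ?_, subset_univ _, fun O hO hxO y _ => ?_⟩
  · rw [SigmaSpace.SemiClosed, compl_univ]
    exact ⟨∅, (κ i).empty_mem, Subset.rfl, empty_subset _⟩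
  · by_contra hy
    have hyx : y = x := by_contra fun hne => hy (hxO hne)
    have hO' : O = {x}ᶜ := Subset.antisymm (fun z hz hzx => hy (by rwa [hyx, ← hzx])) hxO
    exact h (by rwa [SigmaSpace.SemiClosed, ← hO'])

theorem SgClosed.scl_eq {X : Type*} {κ : Fin 2 → SigmaSpace X} {i j : Fin 2} {B : Set X}
    (hB : SgClosed κ i j B) (h : ∀ x, ¬ (κ j).SemiClosed {x} → (κ i).SemiOpen {x}) :
    (κ i).scl B = B := by
  obtain ⟨F, hF, hBF, hFO⟩ := hB
  refine Subset.antisymm (fun x hx => ?_) ((κ i).subset_scl B)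
  by_contra hxB
  by_cases hc : (κ j).SemiClosed {x}
  · exact hFO {x}ᶜ hc (fun y hy hyx => hxB (hyx ▸ hy)) (SigmaSpace.scl_subset hF hBF hx) rfl
  · obtain ⟨y, rfl, hy⟩ := hx {x} (h x hc) rfl
    exact hxB hy

theorem stmt16 {X : Type*} (κ : Fin 2 → SigmaSpace X) :
    PairwiseSemiTOmega κ ↔
      ((∀ x : X, ∀ i j : Fin 2, i ≠ j →
          ¬ (κ i).SemiClosed {x} → (κ j).SemiOpen {x}) ∧
       (∀ i j : Fin 2, i ≠ j →
          {A : Set X | (κ i).SemiClosed ((κ i).scl Aᶜ)} =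
          {A : Set X | SgClosed κ i j (sgCl κ i j Aᶜ)})) := by
  constructor
  · intro hT
    refine ⟨fun x i j hij hx => ?_, fun i j hij => ?_⟩
    · have hcl := hT j i hij.symm _ (sgClosed_compl_singleton j hx)
      rwa [SigmaSpace.SemiClosed, compl_compl] at hcl
    · have hiff : ∀ B, SgClosed κ i j B ↔ (κ i).SemiClosed B :=
        fun B => ⟨hT i j hij B, fun hB => hB.sgClosed j⟩
      simp only [sgCl, hiff, SigmaSpace.scl_eq_sInter]
  · rintro ⟨ha, hb⟩ i j hij B hB
    have hmem : Bᶜ ∈ {A : Set X | (κ i).SemiClosed ((κ i).scl Aᶜ)} := by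
      rw [hb i j hij, mem_ofPred_eq, compl_compl, hB.sgCl_eq]
      exact hB
    rwa [mem_ofPred_eq, compl_compl, hB.scl_eq fun x => ha x j i hij.symm] at hmem
end
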